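/- Let K be a quadratic number field with discriminant D, and for n ≥ 1 let r_K(n) denote the number of nonzero integral ideals of the ring of integers O_K of absolute norm n. Then, for all s with Re(s) > 1, ∑_{n=1}^∞ (r_K(n))² n^{-s} = ( ζ_K(s)² / ζ(2s) ) · ∏_{p | D} (1 + p^{-s})^{-1}, the product running over the rational primes p dividing D. -/

import Mathlib

open Complex

/-- `rK K n` is the number of nonzero integral ideals of the ring of integers of `K`
of absolute norm `n`. -/
noncomputable def rK (K : Type*) [Field K] [NumberField K] (n : ℕ) : ℕ :=
  Nat.card {I : Ideal (NumberField.RingOfIntegers K) // Ideal.absNorm I = n ∧ I ≠ ⊥}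

open scoped NumberField

section Ideals

variable (K : Type*) [Field K] [NumberField K]

lemma rK_eq_card {n : ℕ} (hn : n ≠ 0) :
    rK K n = Nat.card {I : Ideal (𝓞 K) // Ideal.absNorm I = n} := by
  refine Nat.card_congr (Equiv.subtypeEquivRight fun I => ?_)
  rw [and_iff_left_iff_imp]
  rintro rfl rfl
  simp at hn

lemma rK_zero : rK K 0 = 0 := by
  simp [rK, Ideal.absNorm_eq_zero_iff]

lemma rK_one : rK K 1 = 1 := by
  simp [rK_eq_card, Ideal.absNorm_eq_one_iff]

variable {K}

lemma sup_span_mul_sup_span {L : Ideal (𝓞 K)} {m n : ℕ} (hmn : m.Coprime n)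
    (hL : Ideal.absNorm L = m * n) :
    (L ⊔ Ideal.span {(m : 𝓞 K)}) * (L ⊔ Ideal.span {(n : 𝓞 K)}) = L := by
  have hcop : Ideal.span {(m : 𝓞 K)} ⊔ Ideal.span {(n : 𝓞 K)} = ⊤ := by
    rw [← Ideal.isCoprime_iff_sup_eq, Ideal.isCoprime_span_singleton_iff]
    simpa using (Nat.isCoprime_iff_coprime.mpr hmn).map (Int.castRingHom (𝓞 K))
  have hmem : Ideal.span {(m : 𝓞 K)} * Ideal.span {(n : 𝓞 K)} ≤ L := by
    rw [Ideal.span_singleton_mul_span_singleton, Ideal.span_singleton_le_iff_mem,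
      ← Nat.cast_mul, ← hL]
    exact Ideal.absNorm_mem L
  apply le_antisymm
  · rw [Ideal.sup_mul, Ideal.mul_sup, Ideal.mul_sup]
    exact sup_le (sup_le Ideal.mul_le_right Ideal.mul_le_left) (sup_le Ideal.mul_le_right hmem)
  · calc L = L * (Ideal.span {(m : 𝓞 K)} ⊔ Ideal.span {(n : 𝓞 K)}) := by
          rw [hcop, Ideal.mul_top]
      _ ≤ _ := by
          rw [Ideal.mul_sup]
          refine sup_le ?_ (Ideal.mul_mono le_sup_left le_sup_right)
          rw [mul_comm]
          exact Ideal.mul_mono le_sup_right le_sup_left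

lemma absNorm_sup_span_dvd (L : Ideal (𝓞 K)) (m : ℕ) :
    Ideal.absNorm (L ⊔ Ideal.span {(m : 𝓞 K)}) ∣ m ^ Module.finrank ℤ (𝓞 K) := by
  rw [← Ideal.absNorm_span_natCast]
  exact Ideal.absNorm_dvd_absNorm_of_le le_sup_right

lemma absNorm_sup_span {L : Ideal (𝓞 K)} {m n : ℕ} (hmn : m.Coprime n)
    (hL : Ideal.absNorm L = m * n) :
    Ideal.absNorm (L ⊔ Ideal.span {(m : 𝓞 K)}) = m := by
  have h := congrArg Ideal.absNorm (sup_span_mul_sup_span hmn hL)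
  rw [map_mul, hL] at h
  have ha : (Ideal.absNorm (L ⊔ Ideal.span {(m : 𝓞 K)})).Coprime n :=
    (hmn.pow_left _).coprime_dvd_left (absNorm_sup_span_dvd L m)
  have hb : (Ideal.absNorm (L ⊔ Ideal.span {(n : 𝓞 K)})).Coprime m :=
    (hmn.symm.pow_left _).coprime_dvd_left (absNorm_sup_span_dvd L n)
  exact Nat.dvd_antisymm (ha.dvd_of_dvd_mul_right (h ▸ dvd_mul_right _ _))
    (hb.symm.dvd_of_dvd_mul_right (h ▸ dvd_mul_right _ _))

lemma eq_of_le_of_absNorm_eq {I J : Ideal (𝓞 K)} (h : I ≤ J)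
    (hN : Ideal.absNorm I = Ideal.absNorm J) (h0 : Ideal.absNorm J ≠ 0) : I = J := by
  obtain ⟨L, rfl⟩ := Ideal.dvd_iff_le.mpr h
  rw [map_mul, mul_eq_left₀ h0, Ideal.absNorm_eq_one_iff] at hN
  rw [hN, Ideal.mul_top]

lemma mul_sup_span_absNorm {I J : Ideal (𝓞 K)} {m n : ℕ} (hm : m ≠ 0)
    (hmn : m.Coprime n) (hI : Ideal.absNorm I = m) (hJ : Ideal.absNorm J = n) :
    I * J ⊔ Ideal.span {(m : 𝓞 K)} = I := by
  refine eq_of_le_of_absNorm_eq (sup_le Ideal.mul_le_left ?_) ?_ (hI ▸ hm)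
  · rw [Ideal.span_singleton_le_iff_mem, ← hI]
    exact Ideal.absNorm_mem I
  · rw [absNorm_sup_span hmn (by rw [map_mul, hI, hJ]), hI]

variable (K) in
lemma rK_mul {m n : ℕ} (hm : m ≠ 0) (hn : n ≠ 0) (hmn : m.Coprime n) :
    rK K (m * n) = rK K m * rK K n := by
  rw [rK_eq_card K hm, rK_eq_card K hn, rK_eq_card K (mul_ne_zero hm hn), ← Nat.card_prod]
  exact Nat.card_congr
    { toFun L := ⟨⟨L.1 ⊔ Ideal.span {(m : 𝓞 K)}, absNorm_sup_span hmn L.2⟩,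
        ⟨L.1 ⊔ Ideal.span {(n : 𝓞 K)}, absNorm_sup_span hmn.symm (L.2.trans (mul_comm _ _))⟩⟩
      invFun P := ⟨P.1.1 * P.2.1, by rw [map_mul, P.1.2, P.2.2]⟩
      left_inv L := Subtype.ext (sup_span_mul_sup_span hmn L.2)
      right_inv P := Prod.ext (Subtype.ext (mul_sup_span_absNorm hm hmn P.1.2 P.2.2))
        (Subtype.ext (by
          simpa only [mul_comm P.1.1] using mul_sup_span_absNorm hn hmn.symm P.2.2 P.1.2)) }

lemma dvd_discr_iff_exists_sq_dvd {p : ℕ} (hp : p.Prime) :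
    p ∣ (NumberField.discr K).natAbs ↔
      ∃ P : Ideal (𝓞 K), P.IsPrime ∧ P ^ 2 ∣ Ideal.span {(p : 𝓞 K)} := by
  have hpZ : Prime (p : ℤ) := Nat.prime_iff_prime_int.mp hp
  have hp0 : Ideal.span {(p : ℤ)} ≠ ⊥ := by simpa using hp.ne_zero
  have hmap : Ideal.map (algebraMap ℤ (𝓞 K)) (Ideal.span {(p : ℤ)}) =
      Ideal.span {(p : 𝓞 K)} := by simp [Ideal.map_span]
  have key (P : Ideal (𝓞 K)) (hP : P.IsPrime) (hpP : (p : 𝓞 K) ∈ P) :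
      ¬ Algebra.IsUnramifiedAt ℤ P ↔ P ^ 2 ∣ Ideal.span {(p : 𝓞 K)} := by
    have : P.LiesOver (Ideal.span {(p : ℤ)}) :=
      (Ideal.liesOver_span_iff hP.ne_top hpZ).mpr (by simpa using hpP)
    rw [← Ideal.ramificationIdx_eq_one_iff,
      ← Ideal.ramificationIdx'_eq_ramificationIdx (Ideal.span {(p : ℤ)}) P hp0, ← ne_eq,
      Ideal.ramificationIdx'_ne_one_iff, hmap, Ideal.dvd_iff_le]
    rwa [hmap, Ideal.span_singleton_le_iff_mem]
  rw [← Int.natCast_dvd, ← not_iff_not, NumberField.not_dvd_discr_iff_forall_mem K (𝓞 K) hpZ]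
  push Not
  refine forall_congr' fun P => ⟨fun h hP hd => ?_, fun h hP hpP => ?_⟩
  · have hpP : (p : 𝓞 K) ∈ P := by
      rw [← Ideal.span_singleton_le_iff_mem, ← Ideal.dvd_iff_le]
      exact (dvd_pow_self P two_ne_zero).trans hd
    exact (key P hP hpP).mpr hd (h hP (by simpa using hpP))
  · by_contra hu
    exact h hP ((key P hP (by simpa using hpP)).mp hu)

end Ideals

section PrimePowers

variable {K : Type*} [Field K] [NumberField K]

lemma exists_isMaximal_dvd_and_dvd_span {p : ℕ} (hp : p.Prime) {I : Ideal (𝓞 K)}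
    (hI : p ∣ Ideal.absNorm I) :
    ∃ Q : Ideal (𝓞 K), Q.IsMaximal ∧ Q ∣ I ∧ Q ∣ Ideal.span {(p : 𝓞 K)} := by
  obtain ⟨Q, hQ, hu, hd⟩ := Ideal.exists_isMaximal_dvd_of_dvd_absNorm' hp I hI
  refine ⟨Q, hQ, hd, ?_⟩
  rw [Ideal.dvd_iff_le, Ideal.span_singleton_le_iff_mem]
  have : (p : ℤ) ∈ Q.under ℤ := hu ▸ Ideal.mem_span_singleton_self _
  simpa using this

lemma eq_of_dvd_of_isMaximal {R : Type*} [CommSemiring R] {P Q : Ideal R}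
    (hQ : Q.IsMaximal) (hP : P.IsMaximal)
    (h : Q ∣ P) : Q = P :=
  (hP.eq_of_le hQ.ne_top (Ideal.le_of_dvd h)).symm

lemma eq_pow_of_absNorm_eq_prime_pow {p : ℕ} (hp : p.Prime) {P : Ideal (𝓞 K)}
    (hP : P.IsMaximal) {e f : ℕ} (hN : Ideal.absNorm P = p ^ f) (hf : f ≠ 0)
    (hpP : Ideal.span {(p : 𝓞 K)} = P ^ e) (k : ℕ) :
    ∀ I : Ideal (𝓞 K), Ideal.absNorm I = p ^ k → ∃ m, k = f * m ∧ I = P ^ m := by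
  induction k using Nat.strong_induction_on with
  | _ k ih =>
    intro I hI
    rcases eq_or_ne k 0 with rfl | hk
    · exact ⟨0, by simp, by simpa [Ideal.absNorm_eq_one_iff] using hI⟩
    obtain ⟨Q, hQ, hQI, hQp⟩ := exists_isMaximal_dvd_and_dvd_span hp (hI ▸ dvd_pow_self p hk)
    have hQ0 : Q ≠ 0 := by
      rintro rfl
      exact pow_ne_zero k hp.ne_zero (by rw [← hI, zero_dvd_iff.mp hQI, map_zero])
    rw [hpP] at hQp
    obtain rfl := eq_of_dvd_of_isMaximal hQ hP
      ((Ideal.prime_of_isPrime hQ0 hQ.isPrime).dvd_of_dvd_pow hQp)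
    obtain ⟨J, rfl⟩ := hQI
    rw [map_mul, hN] at hI
    have hfk : f ≤ k := (Nat.pow_dvd_pow_iff_le_right hp.one_lt).mp (hI ▸ dvd_mul_right _ _)
    obtain ⟨m, hm, rfl⟩ := ih (k - f) (by lia) J (by
      rw [← Nat.mul_right_inj (pow_ne_zero f hp.ne_zero), hI, ← pow_add]
      congr 1
      lia)
    exact ⟨m + 1, by rw [mul_add]; lia, (pow_succ' _ _).symm⟩

lemma rK_prime_pow_of_span_eq_pow {p : ℕ} (hp : p.Prime) {P : Ideal (𝓞 K)}
    (hP : P.IsMaximal) {e f : ℕ} (hN : Ideal.absNorm P = p ^ f) (hf : f ≠ 0)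
    (hpP : Ideal.span {(p : 𝓞 K)} = P ^ e) (k : ℕ) :
    rK K (p ^ k) = if f ∣ k then 1 else 0 := by
  have key := eq_pow_of_absNorm_eq_prime_pow hp hP hN hf hpP k
  rw [rK_eq_card K (pow_ne_zero k hp.ne_zero)]
  split_ifs with h
  · obtain ⟨m, rfl⟩ := h
    refine Nat.card_eq_one_iff_exists.mpr ⟨⟨P ^ m, by rw [map_pow, hN, pow_mul]⟩, ?_⟩
    rintro ⟨I, hI⟩
    obtain ⟨m', hm, rfl⟩ := key I hI
    rw [mul_right_inj' hf] at hm
    simp [hm]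
  · have : IsEmpty {I : Ideal (𝓞 K) // Ideal.absNorm I = p ^ k} :=
      ⟨fun I => h ((key I.1 I.2).elim fun m hm => ⟨m, hm.1⟩)⟩
    exact Nat.card_of_isEmpty

lemma exists_eq_pow_mul_pow {p : ℕ} (hp : p.Prime) {P Q : Ideal (𝓞 K)}
    (hP : P.IsMaximal) (hQ : Q.IsMaximal) (hNP : Ideal.absNorm P = p)
    (hNQ : Ideal.absNorm Q = p) (hpPQ : Ideal.span {(p : 𝓞 K)} = P * Q) (k : ℕ) :
    ∀ I : Ideal (𝓞 K), Ideal.absNorm I = p ^ k → ∃ i ≤ k, I = P ^ i * Q ^ (k - i) := by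
  induction k with
  | zero => exact fun I hI => ⟨0, le_rfl, by simpa [Ideal.absNorm_eq_one_iff] using hI⟩
  | succ k ih =>
    intro I hI
    obtain ⟨M, hM, hMI, hMp⟩ := exists_isMaximal_dvd_and_dvd_span hp
      (hI ▸ dvd_pow_self p k.succ_ne_zero)
    have hM0 : M ≠ 0 := by
      rintro rfl
      exact pow_ne_zero (k + 1) hp.ne_zero (by rw [← hI, zero_dvd_iff.mp hMI, map_zero])
    obtain ⟨J, rfl⟩ := hMI
    rw [hpPQ] at hMp
    rw [map_mul, pow_succ'] at hI
    have hJ (h : Ideal.absNorm M = p) : ∃ i ≤ k, J = P ^ i * Q ^ (k - i) :=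
      ih J (by rwa [h, Nat.mul_right_inj hp.ne_zero] at hI)
    rcases (Ideal.prime_of_isPrime hM0 hM.isPrime).dvd_or_dvd hMp with h | h
    · obtain rfl := eq_of_dvd_of_isMaximal hM hP h
      obtain ⟨i, hi, rfl⟩ := hJ hNP
      exact ⟨i + 1, by lia, by rw [Nat.add_sub_add_right, pow_succ', mul_assoc]⟩
    · obtain rfl := eq_of_dvd_of_isMaximal hM hQ h
      obtain ⟨i, hi, rfl⟩ := hJ hNQ
      exact ⟨i, by lia, by rw [Nat.sub_add_comm hi, pow_succ', mul_left_comm]⟩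

lemma le_of_pow_mul_pow_eq {P Q : Ideal (𝓞 K)} (hP : P.IsMaximal) (hQ : Q.IsMaximal)
    (hPQ : P ≠ Q) (hP0 : P ≠ 0) {i j i' j' : ℕ} (h : P ^ i * Q ^ j = P ^ i' * Q ^ j') :
    i ≤ i' := by
  have hcop : IsCoprime (P ^ i) (Q ^ j') :=
    (Ideal.isCoprime_iff_sup_eq.mpr (hP.coprime_of_ne hQ hPQ)).pow
  have hd : P ^ i ∣ P ^ i' := hcop.dvd_of_dvd_mul_right (h ▸ dvd_mul_right _ _)
  exact (pow_dvd_pow_iff hP0 (by simpa [Ideal.isUnit_iff] using hP.ne_top)).mp hd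

lemma rK_prime_pow_of_span_eq_mul {p : ℕ} (hp : p.Prime) {P Q : Ideal (𝓞 K)}
    (hP : P.IsMaximal) (hQ : Q.IsMaximal) (hNP : Ideal.absNorm P = p)
    (hNQ : Ideal.absNorm Q = p) (hPQ : P ≠ Q) (hpPQ : Ideal.span {(p : 𝓞 K)} = P * Q) (k : ℕ) :
    rK K (p ^ k) = k + 1 := by
  have hP0 : P ≠ 0 := by
    rintro rfl
    exact hp.ne_zero (by simpa using hNP.symm)
  rw [rK_eq_card K (pow_ne_zero k hp.ne_zero), ← Nat.card_fin (k + 1)]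
  symm
  refine Nat.card_congr (Equiv.ofBijective (fun i : Fin (k + 1) =>
    (⟨P ^ (i : ℕ) * Q ^ (k - i), ?_⟩ : {I : Ideal (𝓞 K) // Ideal.absNorm I = p ^ k})) ⟨?_, ?_⟩)
  · rw [map_mul, map_pow, map_pow, hNP, hNQ, ← pow_add]
    congr 1
    lia
  · intro i j hij
    have h := congrArg Subtype.val hij
    exact Fin.ext (le_antisymm (le_of_pow_mul_pow_eq hP hQ hPQ hP0 h)
      (le_of_pow_mul_pow_eq hP hQ hPQ hP0 h.symm))
  · rintro ⟨I, hI⟩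
    obtain ⟨i, hi, rfl⟩ := exists_eq_pow_mul_pow hp hP hQ hNP hNQ hpPQ k I hI
    exact ⟨⟨i, by lia⟩, rfl⟩

lemma isMaximal_of_absNorm_prime {p : ℕ} (hp : p.Prime) {P : Ideal (𝓞 K)}
    (hN : Ideal.absNorm P = p) : P.IsMaximal := by
  have hprime : P.IsPrime := Ideal.isPrime_of_irreducible_absNorm (by rwa [hN])
  refine hprime.isMaximal ?_
  rintro rfl
  exact hp.ne_zero (by simpa using hN.symm)

variable (K) in
lemma rK_prime_pow_cases (hK2 : Module.finrank ℚ K = 2) {p : ℕ} (hp : p.Prime) :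
    (p ∣ (NumberField.discr K).natAbs ∧ ∀ k, rK K (p ^ k) = 1) ∨
    (¬ p ∣ (NumberField.discr K).natAbs ∧ ∀ k, rK K (p ^ k) = if 2 ∣ k then 1 else 0) ∨
    (¬ p ∣ (NumberField.discr K).natAbs ∧ ∀ k, rK K (p ^ k) = k + 1) := by
  have hNp : Ideal.absNorm (Ideal.span {(p : 𝓞 K)}) = p ^ 2 := by
    rw [Ideal.absNorm_span_natCast, NumberField.RingOfIntegers.rank, hK2]
  obtain ⟨P, hP, -, J, hJ⟩ := exists_isMaximal_dvd_and_dvd_span hp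
    (hNp ▸ dvd_pow_self p two_ne_zero)
  have hmul : Ideal.absNorm P * Ideal.absNorm J = p ^ 2 := by rw [← map_mul, ← hJ, hNp]
  have hP0 : P ≠ 0 := by
    rintro rfl
    exact pow_ne_zero 2 hp.ne_zero (by rw [← hmul, map_zero, zero_mul])
  have hPu : ¬ IsUnit P := by simpa [Ideal.isUnit_iff] using hP.ne_top
  obtain ⟨f, hf2, hf⟩ := (Nat.dvd_prime_pow hp).mp (hmul ▸ dvd_mul_right _ _)
  rw [dvd_discr_iff_exists_sq_dvd hp]
  interval_cases f
  · exact absurd (Ideal.absNorm_eq_one_iff.mp (by simpa using hf)) hP.ne_top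
  · rw [pow_one] at hf
    have hNJ : Ideal.absNorm J = p := by
      rwa [hf, pow_two, Nat.mul_right_inj hp.ne_zero] at hmul
    by_cases hPJ : P = J
    · subst hPJ
      refine .inl ⟨⟨P, hP.isPrime, by rw [hJ, pow_two]⟩, fun k => ?_⟩
      simpa using rK_prime_pow_of_span_eq_pow hp hP (f := 1) (by simpa using hf) one_ne_zero
        (hJ.trans (pow_two P).symm) k
    · have hJm := isMaximal_of_absNorm_prime hp hNJ
      refine .inr (.inr ⟨?_, rK_prime_pow_of_span_eq_mul hp hP hJm hf hNJ hPJ hJ⟩)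
      rintro ⟨Q, hQ, hd⟩
      have hQ0 : Q ≠ 0 := by
        rintro rfl
        rw [zero_pow two_ne_zero, zero_dvd_iff] at hd
        exact pow_ne_zero 2 hp.ne_zero (by rw [← hNp, hd, map_zero])
      have hJ0 : J ≠ 0 := by
        rintro rfl
        exact hp.ne_zero (by simpa using hNJ.symm)
      have hQm : Q.IsMaximal := hQ.isMaximal hQ0
      rw [hJ, pow_two] at hd
      rcases (Ideal.prime_of_isPrime hQ0 hQ).dvd_or_dvd ((dvd_mul_right _ _).trans hd) with h | h
      · obtain rfl := eq_of_dvd_of_isMaximal hQm hP h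
        exact hPJ (eq_of_dvd_of_isMaximal hP hJm ((mul_dvd_mul_iff_left hQ0).mp hd))
      · obtain rfl := eq_of_dvd_of_isMaximal hQm hJm h
        exact hPJ (eq_of_dvd_of_isMaximal hJm hP ((mul_dvd_mul_iff_right hQ0).mp hd)).symm
  · have hJ1 : J = 1 := by
      rw [hf, mul_eq_left₀ (pow_ne_zero 2 hp.ne_zero), Ideal.absNorm_eq_one_iff] at hmul
      rw [hmul, Ideal.one_eq_top]
    rw [hJ1, mul_one] at hJ
    refine .inr (.inl ⟨?_, rK_prime_pow_of_span_eq_pow hp hP hf two_ne_zero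
      (hJ.trans (pow_one P).symm)⟩)
    rintro ⟨Q, hQ, hd⟩
    rw [hJ] at hd
    have hQ0 : Q ≠ 0 := by
      rintro rfl
      rw [zero_pow two_ne_zero, zero_dvd_iff] at hd
      exact hP0 hd
    obtain rfl := eq_of_dvd_of_isMaximal (hQ.isMaximal hQ0) hP ((dvd_pow_self Q two_ne_zero).trans hd)
    have := (pow_dvd_pow_iff (m := 1) hQ0 hPu).mp (by simpa using hd)
    lia

end PrimePowers

section ConvolutionIdentity

open ArithmeticFunction PowerSeries

/-- The power series over `ℤ` whose coefficients are the values of `f` at the powers of `p`. -/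
noncomputable def bellSeries (f : ArithmeticFunction ℕ) (p : ℕ) : ℤ⟦X⟧ :=
  PowerSeries.mk fun k => (f (p ^ k) : ℤ)

lemma bellSeries_mul (f g : ArithmeticFunction ℕ) {p : ℕ} (hp : p.Prime) :
    bellSeries (f * g) p = bellSeries f p * bellSeries g p := by
  ext k
  simp [bellSeries, PowerSeries.coeff_mul, ArithmeticFunction.mul_apply,
    Nat.sum_divisorsAntidiagonal (fun a b => (f a : ℤ) * g b), Nat.sum_divisors_prime_pow hp,
    Finset.Nat.sum_antidiagonal_eq_sum_range_succ (fun a b => (f (p ^ a) : ℤ) * g (p ^ b))]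
  refine Finset.sum_congr rfl fun i hi => ?_
  rw [Nat.pow_div (by simpa [Nat.lt_succ_iff] using hi) hp.pos]

lemma eq_of_bellSeries_eq {f g : ArithmeticFunction ℕ} (hf : f.IsMultiplicative)
    (hg : g.IsMultiplicative) (h : ∀ p : ℕ, p.Prime → bellSeries f p = bellSeries g p) :
    f = g := by
  refine (hf.eq_iff_eq_on_prime_powers f g hg).mpr fun p k hp => ?_
  simpa [bellSeries] using congrArg (PowerSeries.coeff k) (h p hp)

/-- The indicator function of the nonzero perfect squares. -/
noncomputable def squareIndicator : ArithmeticFunction ℕ where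
  toFun n := open Classical in if n ≠ 0 ∧ IsSquare n then 1 else 0
  map_zero' := by simp

/-- The indicator function of the divisors of `N`. -/
noncomputable def dvdIndicator (N : ℕ) : ArithmeticFunction ℕ where
  toFun n := if n ≠ 0 ∧ n ∣ N then 1 else 0
  map_zero' := by simp

open Classical in
lemma squareIndicator_apply (n : ℕ) :
    squareIndicator n = if n ≠ 0 ∧ IsSquare n then 1 else 0 := by
  simp [squareIndicator]

lemma dvdIndicator_apply (N n : ℕ) :
    dvdIndicator N n = if n ≠ 0 ∧ n ∣ N then 1 else 0 := by
  simp [dvdIndicator]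

lemma isSquare_mul_iff_of_coprime {m n : ℕ} (h : m.Coprime n) :
    IsSquare (m * n) ↔ IsSquare m ∧ IsSquare n := by
  refine ⟨fun hsq => ?_, fun ⟨hm, hn⟩ => hm.mul hn⟩
  simp only [isSquare_iff_exists_sq] at hsq ⊢
  obtain ⟨c, hc⟩ := hsq
  exact ⟨exists_eq_pow_of_mul_eq_pow (Nat.isUnit_iff.mpr h) hc,
    exists_eq_pow_of_mul_eq_pow (Nat.isUnit_iff.mpr h.symm) (mul_comm m n ▸ hc)⟩

lemma isMultiplicative_squareIndicator : squareIndicator.IsMultiplicative := by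
  refine IsMultiplicative.iff_ne_zero.mpr ⟨by simp [squareIndicator_apply], ?_⟩
  intro m n hm hn h
  simp only [squareIndicator_apply, isSquare_mul_iff_of_coprime h]
  split_ifs <;> simp_all

lemma isMultiplicative_dvdIndicator (N : ℕ) : (dvdIndicator N).IsMultiplicative := by
  refine IsMultiplicative.iff_ne_zero.mpr ⟨by simp [dvdIndicator_apply], ?_⟩
  intro m n hm hn h
  have : m * n ∣ N ↔ m ∣ N ∧ n ∣ N :=
    ⟨fun hd => ⟨(dvd_mul_right _ _).trans hd, (dvd_mul_left _ _).trans hd⟩,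
      fun hd => h.mul_dvd_of_dvd_of_dvd hd.1 hd.2⟩
  simp only [dvdIndicator_apply, this]
  split_ifs <;> simp_all

variable {K : Type*} [Field K] [NumberField K]

variable (K) in
/-- `rK K` as an arithmetic function. -/
noncomputable def rKArith : ArithmeticFunction ℕ := ⟨rK K, rK_zero K⟩

@[simp] lemma rKArith_apply (n : ℕ) : rKArith K n = rK K n := rfl

lemma isMultiplicative_rKArith : (rKArith K).IsMultiplicative :=
  IsMultiplicative.iff_ne_zero.mpr ⟨rK_one K, fun hm hn h => rK_mul K hm hn h⟩

lemma isSquare_prime_pow_iff {p : ℕ} (hp : p.Prime) (k : ℕ) : IsSquare (p ^ k) ↔ 2 ∣ k := by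
  refine ⟨fun ⟨c, hc⟩ => ?_, fun ⟨m, hm⟩ => ⟨p ^ m, by rw [hm, two_mul, pow_add]⟩⟩
  obtain ⟨m, -, rfl⟩ := (Nat.dvd_prime_pow hp).mp (hc ▸ dvd_mul_right c c)
  rw [← pow_add] at hc
  have := Nat.pow_right_injective hp.two_le hc
  lia

lemma mk_two_dvd_mul_one_sub_sq :
    (PowerSeries.mk fun k => if 2 ∣ k then (1 : ℤ) else 0) * (1 - X ^ 2) = 1 := by
  ext k
  rw [mul_sub, mul_one, map_sub, coeff_mk, coeff_mul_X_pow', coeff_one]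
  rcases k with _ | _ | k
  · simp
  · simp
  · simp

lemma mk_succ_mul_one_sub_sq :
    (PowerSeries.mk fun k => (k : ℤ) + 1) * (1 - X) ^ 2 = 1 := by
  have h := mk_one_mul_one_sub_eq_one ℤ
  have h1 : (PowerSeries.mk fun k => (k : ℤ) + 1) * (1 - X) = PowerSeries.mk 1 := by
    ext k
    rw [mul_sub, mul_one, map_sub, coeff_mk, coeff_mk]
    cases k <;> simp
  rw [pow_two, ← mul_assoc, h1, h]

lemma mk_succ_sq_mul_one_sub_cube :
    (PowerSeries.mk fun k => ((k : ℤ) + 1) ^ 2) * (1 - X) ^ 3 = 1 + X := by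
  have h1 : (PowerSeries.mk fun k => ((k : ℤ) + 1) ^ 2) * (1 - X) =
      (1 + X) * PowerSeries.mk fun k => (k : ℤ) + 1 := by
    ext k
    rw [mul_sub, mul_one, add_mul, one_mul, map_sub, map_add, coeff_mk, coeff_mk]
    cases k
    · simp
    · simp [coeff_succ_X_mul]
      ring
  rw [pow_succ', ← mul_assoc, h1, mul_assoc, mk_succ_mul_one_sub_sq, mul_one]

lemma bellSeries_squareIndicator {p : ℕ} (hp : p.Prime) :
    bellSeries squareIndicator p * (1 - X ^ 2) = 1 := by
  convert mk_two_dvd_mul_one_sub_sq using 2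
  ext k
  simp [bellSeries, squareIndicator_apply, isSquare_prime_pow_iff hp, hp.ne_zero]

lemma bellSeries_dvdIndicator_of_dvd {N p : ℕ} (hN : Squarefree N) (hp : p.Prime) (h : p ∣ N) :
    bellSeries (dvdIndicator N) p = 1 + X := by
  ext k
  have hk (k : ℕ) : ¬ p ^ (k + 2) ∣ N := fun hd => hp.not_isUnit
    (hN p ((pow_two p ▸ pow_dvd_pow p (Nat.le_add_left 2 k)).trans hd))
  rcases k with _ | _ | k
  · simp [bellSeries, dvdIndicator_apply]
  · simp [bellSeries, dvdIndicator_apply, hp.ne_zero, h, coeff_one, coeff_X]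
  · simp [bellSeries, dvdIndicator_apply, hk, coeff_one, coeff_X]

lemma bellSeries_dvdIndicator_of_not_dvd {N p : ℕ} (h : ¬ p ∣ N) :
    bellSeries (dvdIndicator N) p = 1 := by
  ext k
  rcases k with _ | k
  · simp [bellSeries, dvdIndicator_apply]
  · have hk : ¬ p ^ (k + 1) ∣ N := fun hd => h ((dvd_pow_self p k.succ_ne_zero).trans hd)
    simp [bellSeries, dvdIndicator_apply, hk, coeff_one]

lemma rKArith_sq_mul_eq (hK2 : Module.finrank ℚ K = 2) {N : ℕ} (hN : Squarefree N)
    (hND : ∀ p : ℕ, p.Prime → (p ∣ N ↔ p ∣ (NumberField.discr K).natAbs)) :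
    (rKArith K).pmul (rKArith K) * (squareIndicator * dvdIndicator N) =
      rKArith K * rKArith K := by
  have hr : (rKArith K).IsMultiplicative := isMultiplicative_rKArith
  refine eq_of_bellSeries_eq
    ((hr.pmul hr).mul (isMultiplicative_squareIndicator.mul (isMultiplicative_dvdIndicator N)))
    (hr.mul hr) fun p hp => ?_
  rw [bellSeries_mul _ _ hp, bellSeries_mul _ _ hp, bellSeries_mul _ _ hp]
  have hS := bellSeries_squareIndicator hp
  have hX : (1 - X : ℤ⟦X⟧) ≠ 0 := fun h => by simpa using congrArg constantCoeff h
  have hX' : (1 - X ^ 2 : ℤ⟦X⟧) ≠ 0 := fun h => by simpa using congrArg constantCoeff h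
  rcases rK_prime_pow_cases K hK2 hp with ⟨hd, h⟩ | ⟨hd, h⟩ | ⟨hd, h⟩ <;> rw [← hND p hp] at hd
  · have hR : bellSeries (rKArith K) p = PowerSeries.mk 1 := by ext; simp [bellSeries, h]
    have hF : bellSeries ((rKArith K).pmul (rKArith K)) p = PowerSeries.mk 1 := by
      ext; simp [bellSeries, h]
    rw [hR, hF, bellSeries_dvdIndicator_of_dvd hN hp hd]
    congr 1
    refine mul_right_cancel₀ hX ?_
    linear_combination hS - mk_one_mul_one_sub_eq_one ℤ
  · have hF : bellSeries ((rKArith K).pmul (rKArith K)) p = bellSeries (rKArith K) p := by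
      ext; simp [bellSeries, h]
    have hR : bellSeries (rKArith K) p = bellSeries squareIndicator p := by
      ext; simp [bellSeries, h, squareIndicator_apply, isSquare_prime_pow_iff hp, hp.ne_zero]
    rw [hF, hR, bellSeries_dvdIndicator_of_not_dvd hd, mul_one]
  · have hR : bellSeries (rKArith K) p = PowerSeries.mk fun k => (k : ℤ) + 1 := by
      ext; simp [bellSeries, h]
    have hF : bellSeries ((rKArith K).pmul (rKArith K)) p =
        PowerSeries.mk fun k => ((k : ℤ) + 1) ^ 2 := by
      ext; simp [bellSeries, h, pow_two]
    rw [hR, hF, bellSeries_dvdIndicator_of_not_dvd hd, mul_one]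
    refine mul_right_cancel₀ (mul_ne_zero (pow_ne_zero 3 hX) hX') ?_
    have h2 := mk_succ_mul_one_sub_sq
    have h3 := mk_succ_sq_mul_one_sub_cube
    set R := PowerSeries.mk fun k => (k : ℤ) + 1
    set F := PowerSeries.mk fun k => ((k : ℤ) + 1) ^ 2
    linear_combination bellSeries squareIndicator p * (1 - X ^ 2) * h3 + (1 + X) * hS
      - (1 + X) * (R * (1 - X) ^ 2 + 1) * h2

end ConvolutionIdentity

section LSeries

open ArithmeticFunction Filter

section Summability

variable (K : Type*) [Field K] [NumberField K]

lemma sum_rK_add_one (n : ℕ) :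
    ∑ k ∈ Finset.Icc 1 n, rK K k + 1 = Nat.card {I : Ideal (𝓞 K) // Ideal.absNorm I ≤ n} := by
  rw [Finset.sum_congr rfl fun k hk => rK_eq_card K (by
      rw [Finset.mem_Icc] at hk; lia : k ≠ 0),
    show Finset.Icc 1 n = Finset.Ioc 0 n from Finset.Icc_succ_left_eq_Ioc _ _,
    show 1 = Nat.card {I : Ideal (𝓞 K) // Ideal.absNorm I = 0} by simp [Ideal.absNorm_eq_zero_iff],
    Finset.sum_Ioc_add_eq_sum_Icc n.zero_le,
    ← Finset.card_preimage_eq_sum_card_image_eq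
      (fun k _ => Ideal.finite_setOfPred_absNorm_eq k)]
  simp [Set.coe_eq_subtype]

lemma LSeriesSummable_rK {s : ℂ} (hs : 1 < s.re) :
    LSeriesSummable (fun n => (rK K n : ℂ)) s := by
  have h := LSeriesSummable_of_sum_norm_bigO_and_nonneg (f := fun n => (rK K n : ℝ)) (r := 1)
    (Asymptotics.isBigO_atTop_natCast_rpow_of_tendsto_div_rpow (𝕜 := ℝ)
      (a := NumberField.dedekindZeta_residue K) ?_) (fun _ => Nat.cast_nonneg _) zero_le_one hs
  · simpa using h
  refine ((NumberField.Ideal.tendsto_norm_le_div_atTop₀ K).comp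
    tendsto_natCast_atTop_atTop).congr fun n => ?_
  simp only [Function.comp_apply, Nat.cast_le, ← Nat.cast_sum, Real.rpow_one]
  congr
  rw [← add_left_inj 1, ← Ideal.card_norm_le_eq_card_norm_le_add_one, sum_rK_add_one]

end Summability

lemma LSeriesHasSum_squareIndicator {s : ℂ} (hs : 1 < s.re) :
    LSeriesHasSum (fun n => (squareIndicator n : ℂ)) s (riemannZeta (2 * s)) := by
  have hz : LSeriesHasSum 1 (2 * s) (riemannZeta (2 * s)) :=
    LSeriesHasSum_one (by simp; linarith)
  refine ((Nat.pow_left_injective two_ne_zero).hasSum_iff fun n hn => ?_).mp ?_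
  · have : ¬ IsSquare n := fun ⟨m, hm⟩ => hn ⟨m, by simp [hm, pow_two]⟩
    simp [LSeries.term_def, squareIndicator_apply, this]
  · refine Eq.subst (motive := fun f => HasSum f _) (funext fun n => ?_) hz
    symm
    rcases eq_or_ne n 0 with rfl | hn
    · simp
    · have h2 : ((n : ℂ) ^ 2) ^ s = (n : ℂ) ^ (2 * s) := by
        rw [two_mul, Complex.cpow_add _ _ (Nat.cast_ne_zero.mpr hn), pow_two,
          Complex.natCast_mul_natCast_cpow]
      simp [squareIndicator_apply, IsSquare.sq, hn, h2]

/-- The arithmetic function `n ↦ n ^ (-s)`. -/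
noncomputable def cpowNeg (s : ℂ) : ArithmeticFunction ℂ where
  toFun n := if n = 0 then 0 else (n : ℂ) ^ (-s)
  map_zero' := by simp

lemma cpowNeg_apply {n : ℕ} (hn : n ≠ 0) (s : ℂ) : cpowNeg s n = (n : ℂ) ^ (-s) := by
  simp [cpowNeg, hn]

lemma isMultiplicative_cpowNeg (s : ℂ) : (cpowNeg s).IsMultiplicative := by
  refine IsMultiplicative.iff_ne_zero.mpr ⟨by simp [cpowNeg], fun hm hn _ => ?_⟩
  rw [cpowNeg_apply (mul_ne_zero hm hn), cpowNeg_apply hm, cpowNeg_apply hn, Nat.cast_mul,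
    Complex.natCast_mul_natCast_cpow]

lemma LSeriesHasSum_dvdIndicator {N : ℕ} (hN : Squarefree N) (s : ℂ) :
    LSeriesHasSum (fun n => (dvdIndicator N n : ℂ)) s
      (∏ p ∈ N.primeFactors, (1 + (p : ℂ) ^ (-s))) := by
  have h : ∏ p ∈ N.primeFactors, (1 + (p : ℂ) ^ (-s)) =
      ∑ d ∈ N.divisors, LSeries.term (fun n => (dvdIndicator N n : ℂ)) s d := by
    rw [Finset.prod_congr rfl fun p hp => by
        rw [← cpowNeg_apply (Nat.prime_of_mem_primeFactors hp).ne_zero s],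
      (isMultiplicative_cpowNeg s).prodPrimeFactors_one_add_of_squarefree hN]
    refine Finset.sum_congr rfl fun d hd => ?_
    have hd0 : d ≠ 0 := (Nat.pos_of_mem_divisors hd).ne'
    rw [cpowNeg_apply hd0, LSeries.term_of_ne_zero hd0, dvdIndicator_apply,
      if_pos ⟨hd0, Nat.dvd_of_mem_divisors hd⟩, Complex.cpow_neg, Nat.cast_one, one_div]
  rw [h]
  refine hasSum_sum_of_ne_finset_zero fun n hn => ?_
  have : ¬ n ∣ N := fun hd => hn (Nat.mem_divisors.mpr ⟨hd, hN.ne_zero⟩)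
  simp [LSeries.term_def, dvdIndicator_apply, this]

lemma one_add_prime_cpow_neg_ne_zero {p : ℕ} (hp : p.Prime) {s : ℂ} (hs : 0 < s.re) :
    1 + (p : ℂ) ^ (-s) ≠ 0 := by
  intro h
  have hn : ‖(p : ℂ) ^ (-s)‖ < 1 := by
    rw [Complex.norm_natCast_cpow_of_pos hp.pos, Complex.neg_re]
    exact Real.rpow_lt_one_of_one_lt_of_neg (by exact_mod_cast hp.one_lt) (by linarith)
  rw [← neg_eq_of_add_eq_zero_right h, norm_neg, norm_one] at hn
  exact lt_irrefl _ hn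

lemma apply_le_of_mul_eq {f g h : ArithmeticFunction ℕ} (hg : g 1 = 1) (he : f * g = h)
    (n : ℕ) : f n ≤ h n := by
  rcases eq_or_ne n 0 with rfl | hn
  · simp
  rw [← he, ArithmeticFunction.mul_apply]
  refine le_trans ?_ (Finset.single_le_sum (f := fun x : ℕ × ℕ => f x.1 * g x.2)
    (fun _ _ => Nat.zero_le _) (Nat.mem_divisorsAntidiagonal.mpr ⟨mul_one n, hn⟩ : (n, 1) ∈ _))
  simp [hg]

end LSeries

/-- For a quadratic number field `K` of discriminant `D` and `Re s > 1`,
`∑_{n ≥ 1} r_K(n)² n^{-s} = (ζ_K(s)² / ζ(2s)) ∏_{p ∣ D} (1 + p^{-s})⁻¹`,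
where `ζ_K` is given on this half-plane by `ζ_K(s) = ∑_{n ≥ 1} r_K(n) n^{-s}`. -/
theorem rK_sq_dirichlet_series
    (K : Type) [Field K] [NumberField K] (hK2 : Module.finrank ℚ K = 2)
    (s : ℂ) (hs : 1 < s.re) :
    LSeries (fun n => ((rK K n : ℂ)) ^ 2) s =
      (LSeries (fun n => (rK K n : ℂ)) s) ^ 2 / riemannZeta (2 * s) *
        ∏ p ∈ (NumberField.discr K).natAbs.primeFactors,
          (1 + (p : ℂ) ^ (-s))⁻¹ := by
  set D := (NumberField.discr K).natAbs
  have hD0 : D ≠ 0 := Int.natAbs_ne_zero.mpr (NumberField.discr_ne_zero K)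
  set N := UniqueFactorizationMonoid.radical D
  have hN : Squarefree N := UniqueFactorizationMonoid.squarefree_radical
  have hid := rKArith_sq_mul_eq hK2 hN fun p hp =>
    UniqueFactorizationMonoid.dvd_radical_iff_of_irreducible hp hD0
  have hr := (LSeriesSummable_rK K hs).LSeriesHasSum
  have hrr : LSeriesHasSum (fun n => ((rKArith K * rKArith K) n : ℂ)) s
      (LSeries (fun n => (rK K n : ℂ)) s * LSeries (fun n => (rK K n : ℂ)) s) := by
    have := ArithmeticFunction.LSeriesHasSum_mul (f := (rKArith K : ArithmeticFunction ℂ))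
      (g := (rKArith K : ArithmeticFunction ℂ)) (by simpa using hr) (by simpa using hr)
    simpa only [← ArithmeticFunction.natCoe_mul, ArithmeticFunction.natCoe_apply] using this
  have hind := ArithmeticFunction.LSeriesHasSum_mul
    (f := (squareIndicator : ArithmeticFunction ℂ)) (g := (dvdIndicator N : ArithmeticFunction ℂ))
    (by simpa using LSeriesHasSum_squareIndicator hs)
    (by simpa using LSeriesHasSum_dvdIndicator hN s)
  have hsq : LSeriesSummable (fun n => (((rKArith K).pmul (rKArith K)) n : ℂ)) s := by
    refine Summable.of_norm_bounded hrr.LSeriesSummable.norm fun n => LSeries.norm_term_le s ?_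
    rw [Complex.norm_natCast, Complex.norm_natCast, Nat.cast_le]
    exact apply_le_of_mul_eq (by simp [squareIndicator_apply, dvdIndicator_apply]) hid n
  have hmul := ArithmeticFunction.LSeriesHasSum_mul
    (f := ((rKArith K).pmul (rKArith K) : ArithmeticFunction ℕ))
    (by simpa only [ArithmeticFunction.natCoe_apply] using hsq.LSeriesHasSum) hind
  simp only [← ArithmeticFunction.natCoe_mul, hid, ArithmeticFunction.natCoe_apply] at hmul
  have hfin := hmul.unique hrr
  simp only [ArithmeticFunction.pmul_apply, rKArith_apply, ← pow_two, Nat.cast_pow] at hfin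
  rw [Nat.primeFactors_radical] at hfin
  have hz : riemannZeta (2 * s) ≠ 0 := riemannZeta_ne_zero_of_one_lt_re (by simp; linarith)
  have hp : ∏ p ∈ D.primeFactors, (1 + (p : ℂ) ^ (-s)) ≠ 0 := Finset.prod_ne_zero_iff.mpr
    fun p hp => one_add_prime_cpow_neg_ne_zero (Nat.prime_of_mem_primeFactors hp) (by linarith)
  rw [← hfin, Finset.prod_inv_distrib]
  field_simp
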